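/- arXiv:1605.00513 — 6 statements merged into one kernel-verified Lean document; each statement's English description precedes it below -/
import Mathlib

section
/- (Proposition 1, case Π-c: cluster-wise relevance weights for each variable under product-to-one constraints.) Let P ≥ 1, c ≥ 1 and, for i = 1, …, c and j = 1, …, P, let D_{ij} = ∑_{k=1}^N (u_{ik})^m d_W(y_{kj}, g_{ij}) be positive reals. Define λ*_{ij} = (∏_{h=1}^P D_{ih})^{1/P} / D_{ij}. Then for each cluster i, ∏_{j=1}^P λ*_{ij} = 1 with λ*_{ij} > 0, and for every positive array (λ_{ij}) satisfying ∏_{j=1}^P λ_{ij} = 1 for each i, one has ∑_{i=1}^c ∑_{j=1}^P λ*_{ij} D_{ij} ≤ ∑_{i=1}^c ∑_{j=1}^P λ_{ij} D_{ij}. -/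
open Finset

/-- Proposition 1, case Π-c: optimal cluster-wise relevance weights for each variable
under product-to-one constraints, one per cluster. -/
theorem relevance_weights_clusterwise_variable
    (P c : ℕ) (hP : 1 ≤ P) (hc : 1 ≤ c)
    (D : Fin c → Fin P → ℝ) (hD : ∀ i j, 0 < D i j)
    (lamstar : Fin c → Fin P → ℝ)
    (hlamstar : ∀ i j, lamstar i j = (∏ h, D i h) ^ (1/(P:ℝ)) / D i j) :
    (∀ i, ∏ j, lamstar i j = 1) ∧
    (∀ i j, 0 < lamstar i j) ∧
    (∀ lam : Fin c → Fin P → ℝ, (∀ i j, 0 < lam i j) →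
      (∀ i, ∏ j, lam i j = 1) →
      ∑ i, ∑ j, lamstar i j * D i j ≤ ∑ i, ∑ j, lam i j * D i j) := by
  have hP0 : (0:ℝ) < P := by exact_mod_cast hP
  have hprod : ∀ i, 0 < ∏ h, D i h := fun i => Finset.prod_pos fun j _ => hD i j
  refine ⟨fun i => ?_, fun i j => ?_, fun lam hl h1 => ?_⟩
  · simp only [hlamstar]
    rw [Finset.prod_div_distrib, Finset.prod_const, Finset.card_univ, Fintype.card_fin,
      ← Real.rpow_natCast, ← Real.rpow_mul (hprod i).le, one_div_mul_cancel hP0.ne',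
      Real.rpow_one, div_self (hprod i).ne']
  · rw [hlamstar]
    exact div_pos (Real.rpow_pos_of_pos (hprod i) _) (hD i j)
  · refine Finset.sum_le_sum fun i _ => ?_
    have e : ∀ j, lamstar i j * D i j = (∏ h, D i h) ^ (1/(P:ℝ)) := fun j => by
      rw [hlamstar, div_mul_cancel₀ _ (hD i j).ne']
    simp only [e]
    rw [Finset.sum_const, Finset.card_univ, Fintype.card_fin, nsmul_eq_mul]
    have nn : ∀ j ∈ (Finset.univ : Finset (Fin P)), 0 ≤ lam i j * D i j :=
      fun j _ => (mul_pos (hl i j) (hD i j)).le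
    have key := Real.geom_mean_le_arith_mean_weighted Finset.univ
      (fun _ : Fin P => 1/(P:ℝ)) (fun j => lam i j * D i j)
      (fun _ _ => by positivity) (by simp [hP0.ne']) nn
    rw [Real.finsetProd_rpow _ _ nn, Finset.prod_mul_distrib, h1, one_mul,
      ← Finset.mul_sum] at key
    calc _ ≤ (P:ℝ) * (1/(P:ℝ) * ∑ j, lam i j * D i j) := by gcongr
      _ = _ := by field_simp
end

section
/- (Proposition 1, case Π-d: cluster-wise relevance weights for each component of each variable, with 2c separate product-to-one constraints.) Let P ≥ 1, c ≥ 1 and, for i = 1, …, c and j = 1, …, P, let A_{ij} = ∑_{k=1}^N (u_{ik})^m dM_{ik,j} and B_{ij} = ∑_{k=1}^N (u_{ik})^m dV_{ik,j} be positive reals. Define λ*_{ij,M} = (∏_{h=1}^P A_{ih})^{1/P} / A_{ij} and λ*_{ij,V} = (∏_{h=1}^P B_{ih})^{1/P} / B_{ij}. Then for each i, ∏_j λ*_{ij,M} = 1 and ∏_j λ*_{ij,V} = 1 with all λ* positive, and for every positive arrays (λ_{ij,M}), (λ_{ij,V}) satisfying ∏_j λ_{ij,M} = 1 and ∏_j λ_{ij,V}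 = 1 for each i, one has ∑_{i=1}^c ∑_{j=1}^P (λ*_{ij,M} A_{ij} + λ*_{ij,V} B_{ij}) ≤ ∑_{i=1}^c ∑_{j=1}^P (λ_{ij,M} A_{ij} + λ_{ij,V} B_{ij}). -/
open Finset

lemma rw_aux_prod (P : ℕ) (hP : 1 ≤ P) (a l : Fin P → ℝ) (ha : ∀ j, 0 < a j)
    (hl : ∀ j, l j = (∏ h, a h) ^ (1/(P:ℝ)) / a j) :
    (∏ j, l j = 1) ∧ (∀ j, 0 < l j) ∧
    (∀ x : Fin P → ℝ, (∀ j, 0 < x j) → ∏ j, x j = 1 →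
      ∑ j, l j * a j ≤ ∑ j, x j * a j) := by
  have hp : 0 < ∏ h, a h := Finset.prod_pos fun j _ => ha j
  have hP0 : (P:ℝ) ≠ 0 := by positivity
  have hPp : (0:ℝ) < P := by positivity
  refine ⟨?_, ?_, ?_⟩
  · simp only [hl]
    rw [Finset.prod_div_distrib, Finset.prod_const, Finset.card_univ, Fintype.card_fin,
      ← Real.rpow_natCast, ← Real.rpow_mul hp.le, one_div_mul_cancel hP0, Real.rpow_one,
      div_self hp.ne']
  · intro j
    rw [hl]
    exact div_pos (Real.rpow_pos_of_pos hp _) (ha j)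
  · intro x hx hx1
    have h1 : ∀ j, l j * a j = (∏ h, a h) ^ (1/(P:ℝ)) := fun j => by
      rw [hl, div_mul_cancel₀ _ (ha j).ne']
    have h2 := Real.geom_mean_le_arith_mean_weighted Finset.univ (fun _ : Fin P => 1/(P:ℝ))
      (fun j => x j * a j) (fun _ _ => by positivity) (by simp [hP0])
      (fun j _ => (mul_pos (hx j) (ha j)).le)
    rw [Real.finsetProd_rpow _ _ (fun j _ => (mul_pos (hx j) (ha j)).le),
      Finset.prod_mul_distrib, hx1, one_mul, ← Finset.mul_sum] at h2
    simp only [h1, Finset.sum_const, Finset.card_univ, Fintype.card_fin, nsmul_eq_mul]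
    calc _ ≤ (P:ℝ) * (1 / P * ∑ j, x j * a j) := mul_le_mul_of_nonneg_left h2 hPp.le
      _ = _ := by field_simp

/-- Proposition 1, case Π-d: optimal cluster-wise relevance weights for each component
of each variable, with `2c` separate product-to-one constraints. -/
theorem relevance_weights_clusterwise_components
    (P c : ℕ) (hP : 1 ≤ P) (hc : 1 ≤ c)
    (A B : Fin c → Fin P → ℝ) (hA : ∀ i j, 0 < A i j) (hB : ∀ i j, 0 < B i j)
    (lamM lamV : Fin c → Fin P → ℝ)
    (hlamM : ∀ i j, lamM i j = (∏ h, A i h) ^ (1/(P:ℝ)) / A i j)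
    (hlamV : ∀ i j, lamV i j = (∏ h, B i h) ^ (1/(P:ℝ)) / B i j) :
    (∀ i, ∏ j, lamM i j = 1) ∧ (∀ i, ∏ j, lamV i j = 1) ∧
    (∀ i j, 0 < lamM i j) ∧ (∀ i j, 0 < lamV i j) ∧
    (∀ lM lV : Fin c → Fin P → ℝ, (∀ i j, 0 < lM i j) → (∀ i j, 0 < lV i j) →
      (∀ i, ∏ j, lM i j = 1) → (∀ i, ∏ j, lV i j = 1) →
      ∑ i, ∑ j, (lamM i j * A i j + lamV i j * B i j)
        ≤ ∑ i, ∑ j, (lM i j * A i j + lV i j * B i j)) := by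
  have hM := fun i => rw_aux_prod P hP (A i) (lamM i) (hA i) (hlamM i)
  have hV := fun i => rw_aux_prod P hP (B i) (lamV i) (hB i) (hlamV i)
  refine ⟨fun i => (hM i).1, fun i => (hV i).1, fun i => (hM i).2.1, fun i => (hV i).2.1, ?_⟩
  intro lM lV h1 h2 h3 h4
  refine Finset.sum_le_sum fun i _ => ?_
  rw [Finset.sum_add_distrib, Finset.sum_add_distrib]
  exact add_le_add ((hM i).2.2 _ (h1 i) (h3 i)) ((hV i).2.2 _ (h2 i) (h4 i))
end

section
/- (Proposition 1, case Π-e: global relevance weights for each component of each variable under the new joint product-to-one constraint.) Let P ≥ 1 and, for j = 1, …, P, let A_j = ∑_{i=1}^c ∑_{k=1}^N (u_{ik})^m dM_{ik,j} and B_j = ∑_{i=1}^c ∑_{k=1}^N (u_{ik})^m dV_{ik,j} be positive reals. Define λ*_{j,M} = ( ∏_{h=1}^P A_h B_h )^{1/(2P)} / A_j and λ*_{j,V} = ( ∏_{h=1}^P A_h B_h )^{1/(2P)} / B_j. Then ∏_{j=1}^P λ*_{j,M} λ*_{j,V} = 1 with all λ* positive, and for every positive vectors (λ_{j,M}), (λ_{j,V})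 satisfying ∏_{j=1}^P λ_{j,M} λ_{j,V} = 1, one has ∑_{j=1}^P (λ*_{j,M} A_j + λ*_{j,V} B_j) ≤ ∑_{j=1}^P (λ_{j,M} A_j + λ_{j,V} B_j); moreover the minimum value equals 2P · ( ∏_{h=1}^P A_h B_h )^{1/(2P)}. -/
open Finset

/-- Proposition 1, case Π-e: optimal global relevance weights for the two components
of each variable under the new joint product-to-one constraint, with minimum value. -/
theorem relevance_weights_global_joint
    (P : ℕ) (hP : 1 ≤ P)
    (A B : Fin P → ℝ) (hA : ∀ j, 0 < A j) (hB : ∀ j, 0 < B j)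
    (lamM lamV : Fin P → ℝ)
    (hlamM : ∀ j, lamM j = (∏ h, A h * B h) ^ (1/(2*(P:ℝ))) / A j)
    (hlamV : ∀ j, lamV j = (∏ h, A h * B h) ^ (1/(2*(P:ℝ))) / B j) :
    (∏ j, lamM j * lamV j = 1) ∧
    (∀ j, 0 < lamM j) ∧ (∀ j, 0 < lamV j) ∧
    (∀ lM lV : Fin P → ℝ, (∀ j, 0 < lM j) → (∀ j, 0 < lV j) →
      (∏ j, lM j * lV j = 1) →
      ∑ j, (lamM j * A j + lamV j * B j) ≤ ∑ j, (lM j * A j + lV j * B j)) ∧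
    (∑ j, (lamM j * A j + lamV j * B j)
      = 2 * (P:ℝ) * (∏ h, A h * B h) ^ (1/(2*(P:ℝ)))) := by
  have hP0 : (0:ℝ) < P := by exact_mod_cast hP
  have hQ : 0 < ∏ h, A h * B h := Finset.prod_pos fun h _ => mul_pos (hA h) (hB h)
  have hG : 0 < (∏ h, A h * B h) ^ (1/(2*(P:ℝ))) := Real.rpow_pos_of_pos hQ _
  have hGP : ((∏ h, A h * B h) ^ (1/(2*(P:ℝ)))) ^ (2 * P) = ∏ h, A h * B h := by
    rw [← Real.rpow_natCast, ← Real.rpow_mul hQ.le]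
    push_cast
    rw [one_div_mul_cancel (by positivity), Real.rpow_one]
  have hAM : ∀ lM lV : Fin P → ℝ, (∀ j, 0 < lM j) → (∀ j, 0 < lV j) →
      (∏ j, lM j * lV j = 1) →
      2 * (P:ℝ) * (∏ h, A h * B h) ^ (1/(2*(P:ℝ))) ≤ ∑ j, (lM j * A j + lV j * B j) := by
    intro lM lV hM hV h1
    let z : Fin P ⊕ Fin P → ℝ := Sum.elim (fun j => lM j * A j) (fun j => lV j * B j)
    have hz : ∀ i ∈ (Finset.univ : Finset (Fin P ⊕ Fin P)), 0 ≤ z i := by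
      rintro (j | j) _
      · exact (mul_pos (hM j) (hA j)).le
      · exact (mul_pos (hV j) (hB j)).le
    have key := Real.geom_mean_le_arith_mean_weighted Finset.univ
      (fun _ : Fin P ⊕ Fin P => 1/(2*(P:ℝ))) z (fun _ _ => by positivity)
      (by simp; field_simp; norm_num) hz
    rw [Real.finsetProd_rpow _ _ hz, ← Finset.mul_sum, Fintype.prod_sum_type,
      Fintype.sum_sum_type] at key
    simp only [z, Sum.elim_inl, Sum.elim_inr] at key
    rw [← Finset.prod_mul_distrib, ← Finset.sum_add_distrib] at key
    have e : ∏ j, (lM j * A j) * (lV j * B j) = ∏ h, A h * B h := by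
      rw [← one_mul (∏ h, A h * B h), ← h1, ← Finset.prod_mul_distrib]
      exact Finset.prod_congr rfl fun j _ => by ring
    rw [e] at key
    calc _ ≤ 2 * (P:ℝ) * (1/(2*(P:ℝ)) * ∑ j, (lM j * A j + lV j * B j)) := by gcongr
      _ = _ := by field_simp
  generalize hGdef : (∏ h, A h * B h) ^ (1/(2*(P:ℝ))) = G at *
  have hS : ∑ j, (lamM j * A j + lamV j * B j) = 2 * (P:ℝ) * G := by
    have : ∀ j, lamM j * A j + lamV j * B j = 2 * G := fun j => by
      rw [hlamM, hlamV, div_mul_cancel₀ _ (hA j).ne', div_mul_cancel₀ _ (hB j).ne']; ring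
    simp only [this, Finset.sum_const, Finset.card_univ, Fintype.card_fin, nsmul_eq_mul]
    ring
  refine ⟨?_, fun j => ?_, fun j => ?_, fun lM lV hM hV h1 => ?_, hS⟩
  · have : ∀ j, lamM j * lamV j = G ^ 2 / (A j * B j) := fun j => by
      rw [hlamM, hlamV, div_mul_div_comm, sq]
    simp only [this, Finset.prod_div_distrib, Finset.prod_const, Finset.card_univ,
      Fintype.card_fin]
    rw [← pow_mul, hGP, div_self hQ.ne']
  · rw [hlamM]; exact div_pos hG (hA j)
  · rw [hlamV]; exact div_pos hG (hB j)
  · rw [hS]; exact hAM lM lV hM hV h1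
end

section
/- (Proposition 1, case Π-f: cluster-wise relevance weights for each component of each variable under new joint product-to-one constraints, one per cluster.) Let P ≥ 1, c ≥ 1 and, for i = 1, …, c and j = 1, …, P, let A_{ij} = ∑_{k=1}^N (u_{ik})^m dM_{ik,j} and B_{ij} = ∑_{k=1}^N (u_{ik})^m dV_{ik,j} be positive reals. Define λ*_{ij,M} = ( ∏_{h=1}^P A_{ih} B_{ih} )^{1/(2P)} / A_{ij} and λ*_{ij,V} = ( ∏_{h=1}^P A_{ih} B_{ih} )^{1/(2P)} / B_{ij}. Then for each i, ∏_{j=1}^P λ*_{ij,M} λ*_{ij,V} = 1 with all λ* positive, and for every positive arrays (λ_{ij,M}), (λ_{ij,V}) satisfying ∏_{j=1}^P λ_{ij,M} λ_{ij,V} = 1 for each i, one has ∑_{i=1}^c ∑_{j=1}^P (λ*_{ij,M} A_{ij} + λ*_{ij,V} B_{ij}) ≤ ∑_{i=1}^c ∑_{j=1}^P (λ_{ij,M} A_{ij} + λ_{ij,V} B_{ij}). -/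
open Finset

/-- Proposition 1, case Π-f: optimal cluster-wise relevance weights for the two
components of each variable under new joint product-to-one constraints, one per
cluster. -/
theorem relevance_weights_clusterwise_joint
    (P c : ℕ) (hP : 1 ≤ P) (hc : 1 ≤ c)
    (A B : Fin c → Fin P → ℝ) (hA : ∀ i j, 0 < A i j) (hB : ∀ i j, 0 < B i j)
    (lamM lamV : Fin c → Fin P → ℝ)
    (hlamM : ∀ i j, lamM i j = (∏ h, A i h * B i h) ^ (1/(2*(P:ℝ))) / A i j)
    (hlamV : ∀ i j, lamV i j = (∏ h, A i h * B i h) ^ (1/(2*(P:ℝ))) / B i j) :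
    (∀ i, ∏ j, lamM i j * lamV i j = 1) ∧
    (∀ i j, 0 < lamM i j) ∧ (∀ i j, 0 < lamV i j) ∧
    (∀ lM lV : Fin c → Fin P → ℝ, (∀ i j, 0 < lM i j) → (∀ i j, 0 < lV i j) →
      (∀ i, ∏ j, lM i j * lV i j = 1) →
      ∑ i, ∑ j, (lamM i j * A i j + lamV i j * B i j)
        ≤ ∑ i, ∑ j, (lM i j * A i j + lV i j * B i j)) := by
  have hQ : ∀ i, 0 < ∏ h, A i h * B i h :=
    fun i => Finset.prod_pos fun h _ => mul_pos (hA i h) (hB i h)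
  have hP0 : (P : ℝ) ≠ 0 := by
    have : P ≠ 0 := by omega
    exact_mod_cast this
  obtain ⟨G, hGdef⟩ : ∃ G : Fin c → ℝ, ∀ i, G i = (∏ h, A i h * B i h) ^ (1/(2*(P:ℝ))) :=
    ⟨_, fun _ => rfl⟩
  have hG : ∀ i, 0 < G i := fun i => by rw [hGdef]; exact Real.rpow_pos_of_pos (hQ i) _
  have hGP : ∀ i, (G i * G i) ^ P = ∏ h, A i h * B i h := fun i => by
    rw [← pow_two, ← pow_mul, hGdef, ← Real.rpow_natCast, ← Real.rpow_mul (hQ i).le]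
    have : 1 / (2 * (P:ℝ)) * ((2 * P : ℕ) : ℝ) = 1 := by
      push_cast
      field_simp
    rw [this, Real.rpow_one]
  simp only [← hGdef] at hlamM hlamV
  refine ⟨fun i => ?_, fun i j => ?_, fun i j => ?_, ?_⟩
  · have h1 : ∀ j, lamM i j * lamV i j = (G i * G i) / (A i j * B i j) := fun j => by
      rw [hlamM, hlamV, div_mul_div_comm]
    simp only [h1]
    rw [Finset.prod_div_distrib, Finset.prod_const, Finset.card_univ, Fintype.card_fin, hGP]
    exact div_self (hQ i).ne'
  · rw [hlamM]; exact div_pos (hG i) (hA i j)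
  · rw [hlamV]; exact div_pos (hG i) (hB i j)
  · intro lM lV hM hV h1
    refine Finset.sum_le_sum fun i _ => ?_
    have hx : ∀ j, 0 < lM i j * A i j / G i := fun j => div_pos (mul_pos (hM i j) (hA i j)) (hG i)
    have hy : ∀ j, 0 < lV i j * B i j / G i := fun j => div_pos (mul_pos (hV i j) (hB i j)) (hG i)
    have hprod : ∏ j, (lM i j * A i j / G i) * (lV i j * B i j / G i) = 1 := by
      have h2 : ∀ j, (lM i j * A i j / G i) * (lV i j * B i j / G i)
          = (lM i j * lV i j) * (A i j * B i j) / (G i * G i) := fun j => by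
        rw [div_mul_div_comm]; congr 1; ring
      simp only [h2]
      rw [Finset.prod_div_distrib, Finset.prod_mul_distrib, h1, Finset.prod_const,
        Finset.card_univ, Fintype.card_fin, hGP, one_mul]
      exact div_self (hQ i).ne'
    have hlog : ∑ j, Real.log ((lM i j * A i j / G i) * (lV i j * B i j / G i)) = 0 := by
      rw [← Real.log_prod (fun j _ => (mul_pos (hx j) (hy j)).ne'), hprod, Real.log_one]
    have hle : ∑ j, G i * Real.log ((lM i j * A i j / G i) * (lV i j * B i j / G i))
        ≤ ∑ j, ((lM i j * A i j + lV i j * B i j) - (lamM i j * A i j + lamV i j * B i j)) := by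
      refine Finset.sum_le_sum fun j _ => ?_
      rw [Real.log_mul (hx j).ne' (hy j).ne', hlamM, hlamV,
        div_mul_cancel₀ _ (hA i j).ne', div_mul_cancel₀ _ (hB i j).ne']
      have e1 := mul_le_mul_of_nonneg_left (Real.log_le_sub_one_of_pos (hx j)) (hG i).le
      have e2 := mul_le_mul_of_nonneg_left (Real.log_le_sub_one_of_pos (hy j)) (hG i).le
      rw [mul_sub, mul_div_cancel₀ _ (hG i).ne'] at e1 e2
      linarith
    rw [← Finset.mul_sum, hlog, mul_zero, Finset.sum_sub_distrib] at hle
    linarith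
end

section
/- Let γ ∈ ℝ, η > 0, δ ∈ [−1, 1], and let Q(t) = γ + η[ ((1−δ)/2)·ln t − ((1+δ)/2)·ln(1−t) ] for t ∈ (0,1) be the quantile function of the skew logistic distribution, with mean μ = γ + η·δ. Then Q² is integrable on (0,1) and the variance satisfies ∫₀¹ (Q(t))² dt − μ² = η² · ( δ² − (π²/12)·(δ² − 1) ). -/
open MeasureTheory

lemma aux_F_cont : Continuous (fun x : ℝ =>
    4 * (Real.sqrt x * Real.log (Real.sqrt x))^2 - 2 * (x * Real.log x) + 2 * x) := by
  have h := Real.continuous_mul_log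
  have h2 : Continuous (fun x : ℝ => Real.sqrt x * Real.log (Real.sqrt x)) :=
    h.comp Real.continuous_sqrt
  fun_prop

lemma aux_F_deriv (x : ℝ) (hx : 0 < x) : HasDerivAt (fun x : ℝ =>
    4 * (Real.sqrt x * Real.log (Real.sqrt x))^2 - 2 * (x * Real.log x) + 2 * x)
    ((Real.log x)^2) x := by
  have h1 : HasDerivAt (fun x : ℝ => x * (Real.log x)^2 - 2 * (x * Real.log x) + 2 * x)
    ((Real.log x)^2) x := by
    have hl := Real.hasDerivAt_log hx.ne'
    have := ((((hasDerivAt_id x).mul (hl.pow 2)).sub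
      (((hasDerivAt_id x).mul hl).const_mul 2)).add ((hasDerivAt_id x).const_mul 2))
    refine this.congr_deriv ?_
    simp
    field_simp
    ring
  refine h1.congr_of_eventuallyEq ?_
  filter_upwards [lt_mem_nhds hx] with y hy
  rw [Real.log_sqrt hy.le, mul_pow, Real.sq_sqrt hy.le]
  ring

lemma aux_sq_int : IntervalIntegrable (fun x : ℝ => (Real.log x)^2) volume 0 1 := by
  rw [intervalIntegrable_iff_integrableOn_Ioc_of_le zero_le_one]
  exact intervalIntegral.integrableOn_deriv_of_nonneg aux_F_cont.continuousOn
    (fun x hx => aux_F_deriv x hx.1) (fun x _ => sq_nonneg _)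

lemma aux_sq_val : ∫ x in (0:ℝ)..1, (Real.log x)^2 = 2 := by
  rw [intervalIntegral.integral_eq_sub_of_hasDerivAt_of_le zero_le_one aux_F_cont.continuousOn
    (fun x hx => aux_F_deriv x hx.1) aux_sq_int]
  simp

lemma aux_pow_int (n : ℕ) : IntervalIntegrable (fun x : ℝ => x^n * Real.log x) volume 0 1 :=
  intervalIntegral.intervalIntegrable_log'.continuousOn_mul (by fun_prop)

lemma aux_pow_val (n : ℕ) : ∫ x in (0:ℝ)..1, x^n * Real.log x = - (1 / ((n:ℝ)+1)^2) := by
  have hn : (n:ℝ)+1 ≠ 0 := by positivity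
  have hc := Real.continuous_mul_log
  rw [intervalIntegral.integral_eq_sub_of_hasDerivAt_of_le
    (f := fun x : ℝ => x^n * (x * Real.log x) / ((n:ℝ)+1) - x^(n+1) / ((n:ℝ)+1)^2)
    zero_le_one (by fun_prop) ?_ (aux_pow_int n)]
  · simp
  · intro x hx
    have hl := Real.hasDerivAt_log hx.1.ne'
    have h1 : HasDerivAt (fun x : ℝ => x^(n+1) * Real.log x / ((n:ℝ)+1) - x^(n+1) / ((n:ℝ)+1)^2)
      (x^n * Real.log x) x := by
      refine ((((hasDerivAt_pow (n+1) x).mul hl).div_const _).sub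
        ((hasDerivAt_pow (n+1) x).div_const _)).congr_deriv ?_
      have := hx.1.ne'
      push_cast
      try simp only [Nat.add_sub_cancel]
      field_simp
      ring
    have e : (fun x : ℝ => x^n * (x * Real.log x) / ((n:ℝ)+1) - x^(n+1) / ((n:ℝ)+1)^2)
        = (fun x : ℝ => x^(n+1) * Real.log x / ((n:ℝ)+1) - x^(n+1) / ((n:ℝ)+1)^2) := by
      funext y
      ring
    rw [e]
    exact h1

lemma aux_tel : HasSum (fun n : ℕ => 1 / ((n:ℝ)+1) * (1 / ((n:ℝ)+2)^2)) (2 - Real.pi^2/6) := by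
  have h1 : HasSum (fun n : ℕ => 1 / ((n:ℝ)+1) - 1/((n:ℝ)+2)) 1 := by
    rw [hasSum_iff_tendsto_nat_of_nonneg]
    · have : ∀ N : ℕ, ∑ n ∈ Finset.range N, (1 / ((n:ℝ)+1) - 1/((n:ℝ)+2)) = 1 - 1/((N:ℝ)+1) := by
        intro N
        induction N with
        | zero => simp
        | succ k ih =>
          rw [Finset.sum_range_succ, ih]; push_cast; ring
      simp_rw [this]
      simpa using (tendsto_one_div_add_atTop_nhds_zero_nat (𝕜 := ℝ)).const_sub 1
    · intro n
      rw [sub_nonneg]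
      gcongr
      norm_num
  have h2 : HasSum (fun n : ℕ => 1 / ((n:ℝ)+2)^2) (Real.pi^2/6 - 1) := by
    have := (hasSum_nat_add_iff' 2).mpr hasSum_zeta_two
    simpa [Finset.sum_range_succ] using this
  have e : (2 - Real.pi^2/6) = 1 - (Real.pi^2/6 - 1) := by ring
  rw [e]
  have h3 := h1.sub h2
  have e2 : (fun n : ℕ => 1 / ((n:ℝ)+1) * (1 / ((n:ℝ)+2)^2))
      = fun n : ℕ => 1 / ((n:ℝ)+1) - 1/((n:ℝ)+2) - 1 / ((n:ℝ)+2)^2 := by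
    funext n
    have a : (n:ℝ)+1 ≠ 0 := by positivity
    have b : (n:ℝ)+2 ≠ 0 := by positivity
    field_simp
    ring
  rw [e2]
  exact h3

lemma aux_prod_val : ∫ x in Set.Ioo (0:ℝ) 1, Real.log x * Real.log (1-x) = 2 - Real.pi^2/6 := by
  have hval : ∀ n : ℕ, ∫ x in Set.Ioo (0:ℝ) 1, -(1/((n:ℝ)+1)) * (x^(n+1) * Real.log x)
      = 1 / ((n:ℝ)+1) * (1 / ((n:ℝ)+2)^2) := by
    intro n
    rw [integral_const_mul, ← integral_Ioc_eq_integral_Ioo,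
      ← intervalIntegral.integral_of_le zero_le_one, aux_pow_val]
    push_cast
    ring
  have hint : ∀ n : ℕ, Integrable (fun x : ℝ => -(1/((n:ℝ)+1)) * (x^(n+1) * Real.log x))
      (volume.restrict (Set.Ioo (0:ℝ) 1)) := by
    intro n
    exact ((intervalIntegrable_iff_integrableOn_Ioo_of_le zero_le_one).1
      (aux_pow_int (n+1))).const_mul _
  have hnorm : ∀ n : ℕ, ∫ x in Set.Ioo (0:ℝ) 1, ‖-(1/((n:ℝ)+1)) * (x^(n+1) * Real.log x)‖
      = 1 / ((n:ℝ)+1) * (1 / ((n:ℝ)+2)^2) := by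
    intro n
    rw [← hval n]
    refine setIntegral_congr_fun measurableSet_Ioo ?_
    intro x hx
    simp only
    rw [Real.norm_of_nonneg]
    have h1 := Real.log_neg hx.1 hx.2
    have h2 : 0 < x^(n+1) := pow_pos hx.1 _
    have h3 : 0 < 1/((n:ℝ)+1) := by positivity
    nlinarith [mul_pos h3 (mul_pos h2 (neg_pos.2 h1))]
  have hs := hasSum_integral_of_summable_integral_norm hint (by
    simp_rw [hnorm]; exact aux_tel.summable)
  simp_rw [hval] at hs
  rw [← aux_tel.unique hs |>.symm]
  refine setIntegral_congr_fun measurableSet_Ioo ?_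
  intro x hx
  have h := (Real.hasSum_pow_div_log_of_abs_lt_one (x := x)
    (by rw [abs_of_pos hx.1]; exact hx.2)).mul_left (-Real.log x)
  simp only
  rw [show Real.log x * Real.log (1-x) = -Real.log x * -Real.log (1-x) by ring, ← h.tsum_eq]
  congr 1
  funext n
  ring

/-- The square of the skew logistic quantile function is integrable on `(0,1)` and
the variance is `η²·(δ² − (π²/12)·(δ² − 1))`. -/
theorem skew_logistic_variance
    (γ η δ : ℝ) (hη : 0 < η) (hδ : δ ∈ Set.Icc (-1:ℝ) 1)
    (Q : ℝ → ℝ)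
    (hQ : ∀ t ∈ Set.Ioo (0:ℝ) 1,
      Q t = γ + η * ((1-δ)/2 * Real.log t - (1+δ)/2 * Real.log (1-t)))
    (μ : ℝ) (hμ : μ = γ + η * δ) :
    IntegrableOn (fun t => (Q t)^2) (Set.Ioo (0:ℝ) 1) volume ∧
    (∫ t in Set.Ioo (0:ℝ) 1, (Q t)^2) - μ^2
      = η^2 * (δ^2 - Real.pi^2/12 * (δ^2 - 1)) := by
  have conv : ∀ f : ℝ → ℝ, ∫ t in Set.Ioo (0:ℝ) 1, f t = ∫ t in (0:ℝ)..1, f t := by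
    intro f
    rw [← integral_Ioc_eq_integral_Ioo, ← intervalIntegral.integral_of_le zero_le_one]
  have ii : ∀ f : ℝ → ℝ, IntervalIntegrable f volume 0 1 →
      Integrable f (volume.restrict (Set.Ioo (0:ℝ) 1)) := fun f hf =>
    (intervalIntegrable_iff_integrableOn_Ioo_of_le zero_le_one).1 hf
  have i1 := ii _ (intervalIntegral.intervalIntegrable_log' (a := 0) (b := 1))
  have i2 := ii (fun t => Real.log (1-t)) (by
    have := (intervalIntegral.intervalIntegrable_log' (a := 0) (b := 1)).comp_sub_left 1
    simpa using this.symm)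
  have i3 := ii _ aux_sq_int
  have i4 := ii (fun t => (Real.log (1-t))^2) (by
    have := aux_sq_int.comp_sub_left 1
    simpa using this.symm)
  have v1 : ∫ t in Set.Ioo (0:ℝ) 1, Real.log t = -1 := by
    rw [conv, integral_log]; simp
  have v2 : ∫ t in Set.Ioo (0:ℝ) 1, Real.log (1-t) = -1 := by
    rw [conv, intervalIntegral.integral_comp_sub_left (fun t => Real.log t)]
    simp [integral_log]
  have v3 : ∫ t in Set.Ioo (0:ℝ) 1, (Real.log t)^2 = 2 := by
    rw [conv, aux_sq_val]
  have v4 : ∫ t in Set.Ioo (0:ℝ) 1, (Real.log (1-t))^2 = 2 := by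
    rw [conv, intervalIntegral.integral_comp_sub_left (fun t => (Real.log t)^2)]
    simp [aux_sq_val]
  have i5 : Integrable (fun t => Real.log t * Real.log (1-t))
      (volume.restrict (Set.Ioo (0:ℝ) 1)) :=
    ((memLp_two_iff_integrable_sq i1.aestronglyMeasurable).2 i3).integrable_mul
      ((memLp_two_iff_integrable_sq i2.aestronglyMeasurable).2 i4)
  have v5 := aux_prod_val
  have i0 : Integrable (fun _ : ℝ => γ^2) (volume.restrict (Set.Ioo (0:ℝ) 1)) :=
    integrable_const _
  have v0 : ∫ _t in Set.Ioo (0:ℝ) 1, γ^2 = γ^2 := by simp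
  set a := η * ((1-δ)/2) with ha
  set b := η * ((1+δ)/2) with hb
  have heq : Set.EqOn (fun t => (Q t)^2) (fun t => γ^2 + (2*γ*a) * Real.log t
      + (-(2*γ*b)) * Real.log (1-t) + a^2 * (Real.log t)^2 + b^2 * (Real.log (1-t))^2
      + (-(2*a*b)) * (Real.log t * Real.log (1-t))) (Set.Ioo (0:ℝ) 1) := by
    intro t ht
    simp only
    rw [hQ t ht, ha, hb]
    ring
  have j1 := i0.add (i1.const_mul (2*γ*a))
  have j2 := j1.add (i2.const_mul (-(2*γ*b)))
  have j3 := j2.add (i3.const_mul (a^2))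
  have j4 := j3.add (i4.const_mul (b^2))
  have j5 := j4.add (i5.const_mul (-(2*a*b)))
  refine ⟨IntegrableOn.congr_fun j5 heq.symm measurableSet_Ioo, ?_⟩
  rw [setIntegral_congr_fun measurableSet_Ioo heq]
  have e5 := integral_add j4 (i5.const_mul (-(2*a*b)))
  have e4 := integral_add j3 (i4.const_mul (b^2))
  have e3 := integral_add j2 (i3.const_mul (a^2))
  have e2 := integral_add j1 (i2.const_mul (-(2*γ*b)))
  have e1 := integral_add i0 (i1.const_mul (2*γ*a))
  simp only [Pi.add_apply, integral_const_mul] at e1 e2 e3 e4 e5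
  rw [e5, e4, e3, e2, e1, v0, v1, v2, v3, v4, v5, hμ, ha, hb]
  ring
end

section
/- Let Q₁, …, Q_N be quantile functions of skew logistic distributions with parameters (γ_k, η_k, δ_k), k = 1, …, N, where γ_k ∈ ℝ, η_k > 0, δ_k ∈ [−1,1], and let w₁, …, w_N be positive weights. Define γ̄ = (∑_k w_k γ_k)/(∑_k w_k), η̄ = (∑_k w_k η_k)/(∑_k w_k), and δ̄ = (∑_k w_k η_k δ_k)/(∑_k w_k η_k). Then η̄ > 0, δ̄ ∈ [−1,1], and for every t ∈ (0,1), the weighted mean quantile function satisfies (∑_{k=1}^N w_k Q_k(t))/(∑_{k=1}^N w_k) = γ̄ + η̄·[ ((1−δ̄)/2)·ln t − ((1+δ̄)/2)·ln(1−t) ]; that is, the weighted mean of skew logistic quantile functions is again a skew logistic quantile function with parameters (γ̄, η̄, δ̄). -/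
open Finset

/-- The weighted mean of skew logistic quantile functions is again a skew logistic
quantile function, with parameters `γ̄`, `η̄`, `δ̄`. -/
theorem skew_logistic_weighted_mean
    (N : ℕ) (γ η δ : Fin N → ℝ) (w : Fin N → ℝ)
    (hN : 1 ≤ N)
    (hη : ∀ k, 0 < η k) (hδ : ∀ k, δ k ∈ Set.Icc (-1:ℝ) 1)
    (hw : ∀ k, 0 < w k)
    (Q : Fin N → ℝ → ℝ)
    (hQ : ∀ k, ∀ t ∈ Set.Ioo (0:ℝ) 1,
      Q k t = γ k + η k * ((1 - δ k)/2 * Real.log t - (1 + δ k)/2 * Real.log (1-t)))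
    (γbar ηbar δbar : ℝ)
    (hγbar : γbar = (∑ k, w k * γ k) / (∑ k, w k))
    (hηbar : ηbar = (∑ k, w k * η k) / (∑ k, w k))
    (hδbar : δbar = (∑ k, w k * η k * δ k) / (∑ k, w k * η k)) :
    0 < ηbar ∧ δbar ∈ Set.Icc (-1:ℝ) 1 ∧
    ∀ t ∈ Set.Ioo (0:ℝ) 1,
      (∑ k, w k * Q k t) / (∑ k, w k)
        = γbar + ηbar * ((1 - δbar)/2 * Real.log t - (1 + δbar)/2 * Real.log (1-t)) := by
  have hne : (Finset.univ : Finset (Fin N)).Nonempty := ⟨⟨0, hN⟩, Finset.mem_univ _⟩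
  have hW : 0 < ∑ k, w k := Finset.sum_pos (fun k _ => hw k) hne
  have hE : 0 < ∑ k, w k * η k := Finset.sum_pos (fun k _ => mul_pos (hw k) (hη k)) hne
  refine ⟨by rw [hηbar]; exact div_pos hE hW, ?_, ?_⟩
  · rw [hδbar]
    constructor
    · rw [le_div_iff₀ hE, Finset.mul_sum]
      refine Finset.sum_le_sum fun k _ => ?_
      have := mul_le_mul_of_nonneg_left (hδ k).1 (mul_pos (hw k) (hη k)).le
      linarith
    · rw [div_le_iff₀ hE, Finset.mul_sum]
      refine Finset.sum_le_sum fun k _ => ?_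
      have := mul_le_mul_of_nonneg_left (hδ k).2 (mul_pos (hw k) (hη k)).le
      linarith
  · intro t ht
    have key : ∑ k, w k * Q k t = (∑ k, w k * γ k)
        + (∑ k, w k * η k) * ((Real.log t - Real.log (1-t)) / 2)
        - (∑ k, w k * η k * δ k) * ((Real.log t + Real.log (1-t)) / 2) := by
      rw [Finset.sum_mul, Finset.sum_mul, ← Finset.sum_add_distrib, ← Finset.sum_sub_distrib]
      refine Finset.sum_congr rfl fun k _ => ?_
      rw [hQ k t ht]
      ring
    rw [key, hγbar, hηbar, hδbar]
    have h1 := hW.ne'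
    have h2 := hE.ne'
    generalize (∑ k, w k * η k * δ k) = D at *
    generalize (∑ k, w k * η k) = E at *
    generalize (∑ k, w k * γ k) = G at *
    generalize (∑ k, w k) = W at *
    field_simp
    ring
end
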